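/- (Bernstein inequality on the torus) Let d ≥ 1, 0 < s ≤ 2 and 1 < p < ∞. There exists a constant c > 0 depending only on (p, s, d) with the following property: for every smooth ℤ^d-periodic function f : ℝ^d → ℝ with ∫_{[0,1]^d} f dx = 0, setting g = |f|^{p−2} f, one has Re ( ∑_{k ∈ ℤ^d} |k|^s · ĉ_k(f) · conj(ĉ_k(g)) ) ≥ c ∫_{[0,1]^d} |f|^p dx, the sum converging absolutely. (By Parseval the left-hand side equals ∫_{𝕋^d} (Λ^s f) |f|^{p−2} f dx, where Λ^s is the Fourier multiplier |k|^s on the torus.) -/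

import Mathlib

open MeasureTheory

/-- The unit cube `[0,1]^d`, a fundamental domain for `ℤ^d`-periodic functions. -/
def unitBox (d : ℕ) : Set (Fin d → ℝ) :=
  Set.univ.pi fun _ : Fin d => Set.Icc (0 : ℝ) 1

/-- The `k`-th Fourier coefficient `ĉ_k(f) = ∫_{[0,1]^d} f(x) e^{-2πi k·x} dx`. -/
noncomputable def torusCoeff {d : ℕ} (f : (Fin d → ℝ) → ℂ) (k : Fin d → ℤ) : ℂ :=
  ∫ x in unitBox d,
    f x * Complex.exp (-(2 * Real.pi * Complex.I) * (∑ i, (k i : ℂ) * (x i : ℂ)))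

/-- signed power -/
noncomputable def spow (β x : ℝ) : ℝ := |x| ^ (β - 1) * x

lemma spow_eq {β : ℝ} (hβ : 0 < β) (x : ℝ) :
    spow β x = (max x 0) ^ β - (max (-x) 0) ^ β := by
  unfold spow
  rcases lt_trichotomy x 0 with h | h | h
  · rw [max_eq_right h.le, max_eq_left (by linarith), Real.zero_rpow hβ.ne', abs_of_neg h,
      Real.rpow_sub_one (by linarith)]
    have := h.ne
    field_simp
    ring
  · subst h; simp
  · rw [max_eq_left h.le, max_eq_right (by linarith), Real.zero_rpow hβ.ne', abs_of_pos h,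
      Real.rpow_sub_one (by linarith)]
    field_simp
    ring

lemma spow_continuous {β : ℝ} (hβ : 0 < β) : Continuous (spow β) := by
  have : spow β = fun x => (max x 0) ^ β - (max (-x) 0) ^ β := funext (spow_eq hβ)
  rw [this]
  exact ((continuous_id.max continuous_const).rpow_const (fun _ => Or.inr hβ.le)).sub
    ((continuous_neg.max continuous_const).rpow_const (fun _ => Or.inr hβ.le))

lemma spow_mul (β x y : ℝ) : spow β (x * y) = spow β x * spow β y := by
  unfold spow
  rw [abs_mul, Real.mul_rpow (abs_nonneg _) (abs_nonneg _)]; ring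

lemma spow_bound {β : ℝ} (hβ : 0 < β) {r : ℝ} (h1 : -1 ≤ r) (h2 : r ≤ 1) :
    min (1/2) β * (1 - r) ≤ 1 - spow β r ∧ 1 - spow β r ≤ max 2 β * (1 - r) := by
  rcases lt_or_ge r 0 with h | h
  · have e : spow β r = - (-r) ^ β := by
      rw [spow_eq hβ, max_eq_right h.le, max_eq_left (by linarith), Real.zero_rpow hβ.ne']; ring
    have h3 : (-r) ^ β ≤ 1 := Real.rpow_le_one (by linarith) (by linarith) hβ.le
    have h4 : 0 ≤ (-r) ^ β := Real.rpow_nonneg (by linarith) _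
    rw [e]
    have h5 := min_le_left (1/2) β
    have h6 := le_max_left 2 β
    constructor <;> nlinarith
  · have e : spow β r = r ^ β := by
      rw [spow_eq hβ, max_eq_left h, max_eq_right (by linarith), Real.zero_rpow hβ.ne']; ring
    rw [e]
    have h5 := min_le_left (1/2) β
    have h6 := le_max_left 2 β
    have h5' := min_le_right (1/2) β
    have h6' := le_max_right 2 β
    rcases le_total 1 β with hb | hb
    · have h3 := one_add_mul_self_le_rpow_one_add (s := r - 1) (by linarith) hb
      have h4 : r ^ β ≤ r := by
        simpa using Real.rpow_le_rpow_of_exponent_ge' h h2 zero_le_one hb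
      rw [add_sub_cancel] at h3
      constructor <;> nlinarith
    · have h3 := rpow_one_add_le_one_add_mul_self (s := r - 1) (by linarith) hβ.le hb
      have h4 : r ≤ r ^ β := by
        simpa using Real.rpow_le_rpow_of_exponent_ge' h h2 hβ.le hb
      rw [add_sub_cancel] at h3
      constructor <;> nlinarith

lemma abs_rpow_eq {p : ℝ} (hp : 1 < p) (a : ℝ) : spow (p - 1) a * a = |a| ^ p := by
  rcases eq_or_ne a 0 with rfl | h
  · rw [mul_zero, abs_zero, Real.zero_rpow (by linarith)]
  · have h' : 0 < |a| := abs_pos.2 h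
    unfold spow
    rw [mul_assoc, ← abs_mul_abs_self a, show p - 1 - 1 = p - 1 - 1 from rfl]
    rw [Real.rpow_sub_one h'.ne', Real.rpow_sub_one h'.ne']
    field_simp

lemma spow_half_sq {p : ℝ} (hp : 1 < p) (a : ℝ) : spow (p / 2) a ^ 2 = |a| ^ p := by
  rcases eq_or_ne a 0 with rfl | h
  · rw [abs_zero, Real.zero_rpow (by linarith)]; simp [spow]
  · have h' : 0 < |a| := abs_pos.2 h
    unfold spow
    have : |a| ^ p = (|a| ^ (p / 2)) ^ 2 := by
      rw [← Real.rpow_natCast, ← Real.rpow_mul h'.le]; norm_num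
    rw [mul_pow, ← sq_abs a, Real.rpow_sub_one h'.ne', this]
    field_simp

lemma key_pointwise_aux {p : ℝ} (hp : 1 < p) : ∃ c C : ℝ, 0 < c ∧ 0 < C ∧ ∀ a b : ℝ, |b| ≤ |a| →
    c * (spow (p/2) a - spow (p/2) b) ^ 2 ≤ (a - b) * (spow (p-1) a - spow (p-1) b) ∧
    (a - b) * (spow (p-1) a - spow (p-1) b) ≤ C * (spow (p/2) a - spow (p/2) b) ^ 2 := by
  set m := min (1/2) (p-1) with hm
  set M := max 2 (p-1) with hM
  set m' := min (1/2) (p/2) with hm'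
  set M' := max 2 (p/2) with hM'
  have m0 : 0 < m := lt_min (by norm_num) (by linarith)
  have M0 : 0 < M := lt_max_of_lt_left (by norm_num)
  have m0' : 0 < m' := lt_min (by norm_num) (by linarith)
  have M0' : 0 < M' := lt_max_of_lt_left (by norm_num)
  refine ⟨m / M' ^ 2, M / m' ^ 2, by positivity, by positivity, fun a b hab => ?_⟩
  rcases eq_or_ne a 0 with rfl | ha
  · have : b = 0 := by simpa using hab
    subst this; simp
  obtain ⟨r, rfl⟩ : ∃ r, b = r * a := ⟨b / a, by field_simp⟩
  have hr : |r| ≤ 1 := by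
    rw [abs_mul] at hab
    exact le_of_mul_le_mul_right (by simpa using hab) (abs_pos.2 ha)
  obtain ⟨hr1, hr2⟩ := abs_le.1 hr
  obtain ⟨b1, b2⟩ := spow_bound (β := p - 1) (by linarith) hr1 hr2
  obtain ⟨b3, b4⟩ := spow_bound (β := p / 2) (by linarith) hr1 hr2
  rw [← hm] at b1
  rw [← hM] at b2
  rw [← hm'] at b3
  rw [← hM'] at b4
  have hP : 0 ≤ |a| ^ p := by positivity
  have e1 : (a - r * a) * (spow (p-1) a - spow (p-1) (r * a)) =
      |a| ^ p * ((1 - r) * (1 - spow (p-1) r)) := by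
    rw [spow_mul, ← abs_rpow_eq hp]; ring
  have e2 : (spow (p/2) a - spow (p/2) (r * a)) ^ 2 = |a| ^ p * (1 - spow (p/2) r) ^ 2 := by
    rw [spow_mul, ← spow_half_sq hp]; ring
  rw [e1, e2]
  have r0 : 0 ≤ 1 - r := by linarith
  have q1 : (1 - spow (p/2) r) ^ 2 ≤ M' ^ 2 * (1 - r) ^ 2 := by
    rw [← mul_pow]; exact pow_le_pow_left₀ (le_trans (by positivity) b3) b4 2
  have q2 : m' ^ 2 * (1 - r) ^ 2 ≤ (1 - spow (p/2) r) ^ 2 := by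
    rw [← mul_pow]; exact pow_le_pow_left₀ (by positivity) b3 2
  constructor
  · calc m / M' ^ 2 * (|a| ^ p * (1 - spow (p/2) r) ^ 2) 
        ≤ m / M' ^ 2 * (|a| ^ p * (M' ^ 2 * (1 - r) ^ 2)) := by gcongr
      _ = |a| ^ p * ((1 - r) * (m * (1 - r))) := by field_simp
      _ ≤ _ := by gcongr
  · calc |a| ^ p * ((1 - r) * (1 - spow (p-1) r)) ≤ |a| ^ p * ((1 - r) * (M * (1 - r))) := by gcongr
      _ = M / m' ^ 2 * (|a| ^ p * (m' ^ 2 * (1 - r) ^ 2)) := by field_simp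
      _ ≤ _ := by gcongr

lemma key_pointwise {p : ℝ} (hp : 1 < p) : ∃ c C : ℝ, 0 < c ∧ 0 < C ∧ ∀ a b : ℝ,
    c * (spow (p/2) a - spow (p/2) b) ^ 2 ≤ (a - b) * (spow (p-1) a - spow (p-1) b) ∧
    (a - b) * (spow (p-1) a - spow (p-1) b) ≤ C * (spow (p/2) a - spow (p/2) b) ^ 2 := by
  obtain ⟨c, C, hc, hC, h⟩ := key_pointwise_aux hp
  refine ⟨c, C, hc, hC, fun a b => ?_⟩
  rcases le_total |b| |a| with hab | hab
  · exact h a b hab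
  · have := h b a hab
    constructor <;> nlinarith [this.1, this.2]

lemma exp_bounds {t : ℝ} (ht : 0 ≤ t) : 0 ≤ 1 - Real.exp (-t) ∧ 1 - Real.exp (-t) ≤ t ∧
    1 - Real.exp (-t) ≤ 1 := by
  refine ⟨?_, ?_, ?_⟩
  · have := Real.exp_le_one_iff.2 (show -t ≤ 0 by linarith); linarith
  · have := Real.add_one_le_exp (-t); linarith
  · have := Real.exp_pos (-t); linarith

lemma levy_integrable {s : ℝ} (hs0 : 0 < s) (hs2 : s < 2) :
    IntegrableOn (fun t : ℝ => (1 - Real.exp (-t)) * t ^ (-1 - s / 2)) (Set.Ioi 0) := by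
  have hmeas : Measurable (fun t : ℝ => (1 - Real.exp (-t)) * t ^ (-1 - s / 2)) := by fun_prop
  rw [← Set.Ioc_union_Ioi_eq_Ioi (zero_le_one (α := ℝ))]
  apply IntegrableOn.union
  · have h1 : IntegrableOn (fun t : ℝ => t ^ (-s / 2)) (Set.Ioc 0 1) := by
      rw [← intervalIntegrable_iff_integrableOn_Ioc_of_le zero_le_one]
      exact intervalIntegral.intervalIntegrable_rpow' (by linarith)
    refine Integrable.mono' h1 hmeas.aestronglyMeasurable ?_
    filter_upwards [ae_restrict_mem measurableSet_Ioc] with t ht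
    obtain ⟨e1, e2, e3⟩ := exp_bounds ht.1.le
    have := Real.rpow_nonneg ht.1.le (-1 - s/2)
    rw [Real.norm_of_nonneg (by positivity)]
    calc _ ≤ t * t ^ (-1 - s/2) := by gcongr
      _ = t ^ (-s/2) := by
        rw [mul_comm, ← Real.rpow_add_one ht.1.ne']; congr 1; ring
  · have h1 : IntegrableOn (fun t : ℝ => t ^ (-1 - s / 2)) (Set.Ioi 1) :=
      integrableOn_Ioi_rpow_of_lt (by linarith) one_pos
    refine Integrable.mono' h1 hmeas.aestronglyMeasurable ?_
    filter_upwards [ae_restrict_mem measurableSet_Ioi] with t ht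
    have ht0 : (0:ℝ) < t := lt_trans one_pos ht
    obtain ⟨e1, e2, e3⟩ := exp_bounds ht0.le
    have := Real.rpow_nonneg ht0.le (-1 - s/2)
    rw [Real.norm_of_nonneg (by positivity)]
    exact mul_le_of_le_one_left this e3

lemma levy_scale_fun {s q : ℝ} (hq : 0 < q) {t : ℝ} (ht : 0 < t) :
    (1 - Real.exp (-t * q)) * t ^ (-1 - s / 2) =
      q ^ (1 + s / 2) * ((1 - Real.exp (-(q * t))) * (q * t) ^ (-1 - s / 2)) := by
  rw [Real.mul_rpow hq.le ht.le, show -1 - s / 2 = -(1 + s/2) by ring, Real.rpow_neg hq.le]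
  have : q ^ (1 + s/2) ≠ 0 := (Real.rpow_pos_of_pos hq _).ne'
  field_simp

lemma levy_scale {s : ℝ} (hs0 : 0 < s) (hs2 : s < 2) {q : ℝ} (hq : 0 ≤ q) :
    IntegrableOn (fun t : ℝ => (1 - Real.exp (-t * q)) * t ^ (-1 - s / 2)) (Set.Ioi 0) ∧
    ∫ t in Set.Ioi (0:ℝ), (1 - Real.exp (-t * q)) * t ^ (-1 - s / 2) =
      q ^ (s / 2) * ∫ t in Set.Ioi (0:ℝ), (1 - Real.exp (-t)) * t ^ (-1 - s / 2) := by
  rcases hq.eq_or_lt with rfl | hq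
  · simp [Real.zero_rpow (show s / 2 ≠ 0 by linarith)]
  constructor
  · rw [integrableOn_congr_fun (fun t (ht : t ∈ Set.Ioi (0:ℝ)) => levy_scale_fun (s := s) hq ht)
      measurableSet_Ioi]
    apply Integrable.const_mul
    have := (integrableOn_Ioi_comp_mul_left_iff (fun t : ℝ => (1 - Real.exp (-t)) * t ^ (-1 - s / 2)) 0 hq).2
      (by simpa using levy_integrable hs0 hs2)
    exact this
  · rw [setIntegral_congr_fun measurableSet_Ioi (fun t ht => levy_scale_fun (s := s) hq ht), integral_const_mul,
      integral_comp_mul_left_Ioi (fun t : ℝ => (1 - Real.exp (-t)) * t ^ (-1 - s / 2)) 0 hq]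
    rw [mul_zero, smul_eq_mul, ← mul_assoc, Real.rpow_add hq, Real.rpow_one]
    congr 1
    field_simp

lemma levy_pos {s : ℝ} (hs0 : 0 < s) (hs2 : s < 2) :
    0 < ∫ t in Set.Ioi (0:ℝ), (1 - Real.exp (-t)) * t ^ (-1 - s / 2) := by
  rw [setIntegral_pos_iff_support_of_nonneg_ae]
  · have : (Function.support fun t : ℝ => (1 - Real.exp (-t)) * t ^ (-1 - s / 2)) ∩ Set.Ioi 0 = Set.Ioi 0 := by
      apply Set.inter_eq_right.2
      intro t ht
      have ht : 0 < t := ht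
      have h1 : Real.exp (-t) < 1 := Real.exp_lt_one_iff.2 (by linarith)
      have h2 := Real.rpow_pos_of_pos ht (-1 - s/2)
      exact (mul_pos (by linarith) h2).ne'
    rw [this]; simp
  · filter_upwards [ae_restrict_mem measurableSet_Ioi] with t ht
    exact mul_nonneg (exp_bounds (le_of_lt ht)).1 (Real.rpow_nonneg (le_of_lt ht) _)
  · exact levy_integrable hs0 hs2

/-- abstract passage from heat to fractional, nonnegativity version -/
lemma frac_of_heat_core {ι : Type*} [Countable ι] (q a : ι → ℝ) (hq0 : ∀ k, 0 ≤ q k)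
    (hsum : Summable fun k => q k * |a k|)
    (h : ∀ t : ℝ, 0 < t → 0 ≤ ∑' k, (1 - Real.exp (-t * q k)) * a k)
    {s : ℝ} (hs0 : 0 < s) (hs2 : s ≤ 2) (hS : Summable fun k => q k ^ (s / 2) * |a k|) :
    0 ≤ ∑' k, q k ^ (s / 2) * a k := by
  rcases hs2.lt_or_eq with hs2 | rfl
  · set c := ∫ t in Set.Ioi (0:ℝ), (1 - Real.exp (-t)) * t ^ (-1 - s / 2) with hc
    have cpos : 0 < c := levy_pos hs0 hs2
    have hint := fun k => (levy_scale hs0 hs2 (hq0 k)).1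
    have hval := fun k => (levy_scale hs0 hs2 (hq0 k)).2
    have hnorm : ∀ k, ∫ t in Set.Ioi (0:ℝ), ‖(1 - Real.exp (-t * q k)) * t ^ (-1 - s / 2) * a k‖ =
        q k ^ (s/2) * c * |a k| := by
      intro k
      rw [← hval, ← integral_mul_const]
      apply setIntegral_congr_fun measurableSet_Ioi
      intro t ht
      have ht : 0 < t := ht
      have h1 := (exp_bounds (mul_nonneg ht.le (hq0 k))).1
      have h2 := Real.rpow_nonneg ht.le (-1 - s/2)
      rw [← neg_mul] at h1
      simp only [norm_mul, Real.norm_eq_abs]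
      rw [abs_of_nonneg h1, abs_of_nonneg h2]
    have hs1 : Summable fun k =>
        ∫ t in Set.Ioi (0:ℝ), ‖(1 - Real.exp (-t * q k)) * t ^ (-1 - s / 2) * a k‖ := by
      simp only [hnorm]
      exact (hS.mul_left c).congr (fun k => by ring)
    have hi := fun k => (hint k).mul_const (a k)
    have key := (hasSum_integral_of_summable_integral_norm hi hs1).tsum_eq
    have e1 : ∀ k, ∫ t in Set.Ioi (0:ℝ), (1 - Real.exp (-t * q k)) * t ^ (-1 - s / 2) * a k =
        c * (q k ^ (s/2) * a k) := by
      intro k; rw [integral_mul_const, hval]; ring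
    simp only [e1] at key
    rw [tsum_mul_left] at key
    have : 0 ≤ c * ∑' k, q k ^ (s/2) * a k := by
      rw [key]
      apply setIntegral_nonneg measurableSet_Ioi
      intro t ht
      have ht : 0 < t := ht
      have h2 := Real.rpow_nonneg ht.le (-1 - s/2)
      have e2 : ∑' k, (1 - Real.exp (-t * q k)) * t ^ (-1 - s / 2) * a k =
        t ^ (-1 - s / 2) * ∑' k, (1 - Real.exp (-t * q k)) * a k := by
        rw [← tsum_mul_left]; congr 1; ext k; ring
      rw [e2]
      exact mul_nonneg h2 (h t ht)
    exact nonneg_of_mul_nonneg_right this cpos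
  · have hl : Filter.Tendsto (fun t : ℝ => ∑' k, (1 - Real.exp (-t * q k)) / t * a k)
        (nhdsWithin 0 (Set.Ioi 0)) (nhds (∑' k, q k ^ ((2:ℝ) / 2) * a k)) := by
      apply tendsto_tsum_of_dominated_convergence hsum
      · intro k
        apply Filter.Tendsto.mul_const
        have : HasDerivAt (fun t : ℝ => 1 - Real.exp (-t * q k)) (q k) 0 := by
          have := (((hasDerivAt_id (0:ℝ)).neg.mul_const (q k)).exp).const_sub 1
          simpa using this
        have := this.tendsto_slope_zero_right
        simp at this ⊢
        simpa [div_eq_inv_mul] using this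
      · filter_upwards [self_mem_nhdsWithin] with t ht k
        have ht : 0 < t := ht
        obtain ⟨h1, h2, -⟩ := exp_bounds (mul_nonneg ht.le (hq0 k))
        rw [← neg_mul] at h1 h2
        rw [norm_mul, Real.norm_eq_abs, Real.norm_eq_abs, abs_of_nonneg (div_nonneg h1 ht.le)]
        gcongr
        rw [div_le_iff₀ ht]; linarith
    refine ge_of_tendsto hl ?_
    filter_upwards [self_mem_nhdsWithin] with t ht
    have ht : 0 < t := ht
    have e : ∑' k, (1 - Real.exp (-t * q k)) / t * a k =
        (∑' k, (1 - Real.exp (-t * q k)) * a k) / t := by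
      rw [← tsum_div_const]; congr 1; ext k; ring
    rw [e]
    exact div_nonneg (h t ht) ht.le

lemma frac_of_heat {ι : Type*} [Countable ι] (q a : ι → ℝ) (hq : ∀ k, q k = 0 ∨ 1 ≤ q k)
    (k0 : ι) (hk0 : q k0 = 1)
    (hsum : Summable fun k => q k * |a k|) (A : ℝ)
    (h : ∀ t : ℝ, 0 < t → A * (1 - Real.exp (-t)) ≤ ∑' k, (1 - Real.exp (-t * q k)) * a k)
    {s : ℝ} (hs0 : 0 < s) (hs2 : s ≤ 2) :
    (Summable fun k => q k ^ (s / 2) * |a k|) ∧ A ≤ ∑' k, q k ^ (s / 2) * a k := by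
  classical
  have hq0 : ∀ k, 0 ≤ q k := fun k => by rcases hq k with h | h <;> linarith
  have hS : ∀ a : ι → ℝ, (Summable fun k => q k * |a k|) →
      Summable fun k => q k ^ (s / 2) * |a k| := by
    intro a hsum
    refine Summable.of_nonneg_of_le (fun k => mul_nonneg (Real.rpow_nonneg (hq0 k) _) (abs_nonneg _))
      (fun k => ?_) hsum
    apply mul_le_mul_of_nonneg_right _ (abs_nonneg _)
    rcases hq k with h | h
    · rw [h, Real.zero_rpow (by linarith)]
    · simpa using Real.rpow_le_rpow_of_exponent_le h (show s / 2 ≤ 1 by linarith)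
  refine ⟨hS a hsum, ?_⟩
  have hone : ∀ m : ι → ℝ, HasSum (fun k => m k * (if k = k0 then A else 0)) (m k0 * A) := by
    intro m
    convert hasSum_ite_eq k0 (m k0 * A) using 2 with k
    split_ifs with hk
    · rw [hk]
    · simp
  have hsum' : Summable fun k => q k * |a k - if k = k0 then A else 0| := by
    have h2 : Summable (fun k => q k * |if k = k0 then A else 0|) := by
      have := (hone q).summable.abs
      refine this.congr fun k => ?_
      rw [abs_mul, abs_of_nonneg (hq0 k)]
    refine Summable.of_nonneg_of_le (fun k => mul_nonneg (hq0 k) (abs_nonneg _)) (fun k => ?_)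
      (hsum.add h2)
    rw [← mul_add]
    exact mul_le_mul_of_nonneg_left (abs_sub _ _) (hq0 k)
  have main := frac_of_heat_core q (fun k => a k - if k = k0 then A else 0) hq0 hsum' ?_ hs0 hs2
    (hS _ hsum')
  · have s1 : Summable fun k => q k ^ (s/2) * a k := by
      refine Summable.of_norm_bounded (hS a hsum) (fun k => ?_)
      rw [norm_mul, Real.norm_eq_abs, Real.norm_eq_abs, abs_of_nonneg (Real.rpow_nonneg (hq0 k) _)]
    have e := (s1.hasSum.sub (hone (fun k => q k ^ (s/2)))).tsum_eq
    simp only [mul_sub] at main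
    rw [e, hk0, Real.one_rpow] at main
    linarith
  · intro t ht
    have s1 : Summable fun k => (1 - Real.exp (-t * q k)) * a k := by
      refine Summable.of_norm_bounded (hsum.mul_left t) (fun k => ?_)
      obtain ⟨h1, h2, -⟩ := exp_bounds (mul_nonneg ht.le (hq0 k))
      rw [← neg_mul] at h1 h2
      rw [norm_mul, Real.norm_eq_abs, Real.norm_eq_abs, abs_of_nonneg h1, ← mul_assoc]
      gcongr
    have e := (s1.hasSum.sub (hone (fun k => 1 - Real.exp (-t * q k)))).tsum_eq
    simp only [mul_sub]
    rw [e, hk0, mul_one]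
    have := h t ht
    linarith

lemma sum_sq_ge_one {d : ℕ} (k : Fin d → ℤ) (hk : k ≠ 0) : (1:ℝ) ≤ ∑ i, (k i : ℝ) ^ 2 := by
  obtain ⟨i, hi⟩ := Function.ne_iff.1 hk
  have h1 : (1:ℝ) ≤ (k i : ℝ) ^ 2 := by
    have : (1:ℤ) ≤ (k i) ^ 2 := by
      have : 0 < (k i) ^ 2 := by
        have : k i ≠ 0 := hi
        positivity
      omega
    exact_mod_cast this
  exact h1.trans (Finset.single_le_sum (f := fun i => (k i : ℝ) ^ 2) (fun j _ => sq_nonneg _)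
    (Finset.mem_univ i))
noncomputable local instance : MeasureSpace UnitAddCircle := ⟨AddCircle.haarAddCircle⟩

local instance : Measure.IsAddHaarMeasure (volume : Measure UnitAddCircle) :=
  inferInstanceAs (Measure.IsAddHaarMeasure AddCircle.haarAddCircle)

local instance : IsProbabilityMeasure (volume : Measure UnitAddCircle) :=
  inferInstanceAs (IsProbabilityMeasure AddCircle.haarAddCircle)

open UnitAddTorus

abbrev TT (d : ℕ) := UnitAddTorus (Fin d)

/-- projection -/
def prj {d : ℕ} (x : Fin d → ℝ) : TT d := fun i => (x i : UnitAddCircle)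

lemma prj_add {d : ℕ} (x y : Fin d → ℝ) : prj (x + y) = prj x + prj y := by
  ext i; simp [prj]

lemma prj_oqm {d : ℕ} : IsOpenQuotientMap (prj (d := d)) :=
  IsOpenQuotientMap.piMap (fun _ => QuotientAddGroup.isOpenQuotientMap_mk)

lemma descend {d : ℕ} {E : Type*} [TopologicalSpace E] (f : (Fin d → ℝ) → E) (hf : Continuous f)
    (hper : ∀ (x : Fin d → ℝ) (k : Fin d → ℤ), f (x + fun i => (k i : ℝ)) = f x) :
    ∃ F : C(TT d, E), ∀ x, F (prj x) = f x := by
  have key : ∀ x y, prj x = prj y → f x = f y := by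
    intro x y h
    have : ∀ i, ∃ n : ℤ, y i + n = x i := by
      intro i
      have := congrFun h i
      simp only [prj] at this
      rw [eq_comm, QuotientAddGroup.eq, AddSubgroup.mem_zmultiples_iff] at this
      obtain ⟨n, hn⟩ := this
      refine ⟨n, ?_⟩
      simp at hn
      linarith
    choose n hn using this
    rw [← hper y n]
    congr 1
    ext i; simp [hn]
  have hq : Topology.IsQuotientMap (⟨prj, prj_oqm.continuous⟩ : C(Fin d → ℝ, TT d)) :=
    prj_oqm.isQuotientMap
  refine ⟨hq.lift ⟨f, hf⟩ (fun a b h => key a b h), fun x => ?_⟩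
  have := DFunLike.congr_fun (hq.lift_comp ⟨f, hf⟩ (fun a b h => key a b h)) x
  exact this

lemma parseval {d : ℕ} (U V : C(TT d, ℂ)) :
    HasSum (fun k => (starRingEnd ℂ) (mFourierCoeff U k) * mFourierCoeff V k)
      (∫ t, (starRingEnd ℂ) (U t) * V t) := by
  have := hasSum_prod_mFourierCoeff (U.toLp 2 volume ℂ) (V.toLp 2 volume ℂ)
  simp only [mFourierCoeff_toLp] at this
  convert this using 1
  apply integral_congr_ae
  filter_upwards [U.coeFn_toLp (p := 2) (𝕜 := ℂ) volume, V.coeFn_toLp (p := 2) (𝕜 := ℂ) volume] with t h1 h2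
  rw [h1, h2]

lemma mF_add {d : ℕ} (k : Fin d → ℤ) (x y : TT d) :
    mFourier k (x + y) = mFourier k x * mFourier k y := by
  simp [mFourier, ← Finset.prod_mul_distrib, fourier_apply, smul_add, AddCircle.toCircle_add]

lemma mF_norm {d : ℕ} (k : Fin d → ℤ) (x : TT d) : ‖mFourier k x‖ = 1 := by
  simp only [mFourier, fourier_apply, ContinuousMap.coe_mk, norm_prod, Circle.norm_coe,
    Finset.prod_const_one]

lemma mF_neg_mul {d : ℕ} (k : Fin d → ℤ) (y : TT d) : mFourier k y * mFourier (-k) y = 1 := by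
  rw [← mFourier_add, add_neg_cancel, mFourier_zero]; rfl

lemma coeff_translate {d : ℕ} (U : TT d → ℂ) (y : TT d) (k : Fin d → ℤ) :
    mFourierCoeff (fun x => U (x + y)) k = mFourier k y * mFourierCoeff U k := by
  unfold mFourierCoeff
  rw [← integral_add_right_eq_self (fun x => mFourier (-k) x • U x) y, ← integral_const_mul]
  congr 1
  ext x
  rw [mF_add, smul_eq_mul, smul_eq_mul]
  linear_combination (-mFourier (-k) x * U (x + y)) * (mF_neg_mul k y)

lemma mF_prj {d : ℕ} (k : Fin d → ℤ) (x : Fin d → ℝ) :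
    mFourier k (prj x) = Complex.exp ((2 * Real.pi * Complex.I) * (∑ i, (k i : ℂ) * (x i : ℂ))) := by
  simp only [mFourier, prj, ContinuousMap.coe_mk, fourier_coe_apply]
  rw [← Complex.exp_sum, Finset.mul_sum]
  congr 1
  apply Finset.sum_congr rfl
  intro i _
  simp; ring

lemma box_integral {d : ℕ} {E : Type*} [NormedAddCommGroup E] [NormedSpace ℝ E] (F : TT d → E) :
    ∫ x in unitBox d, F (prj x) = ∫ t, F t := by
  rw [integral_preimage F (fun _ => 0)]
  have : (volume : Measure (Fin d → ℝ)).restrict (unitBox d) =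
      volume.restrict {x | ∀ i : Fin d, x i ∈ Set.Ioc (0 : ℝ) (0 + 1)} := by
    have e : {x : Fin d → ℝ | ∀ i : Fin d, x i ∈ Set.Ioc (0 : ℝ) (0 + 1)} =
      Set.univ.pi fun _ : Fin d => Set.Ioc (0 : ℝ) 1 := by ext; simp
    rw [e, unitBox, volume_pi, Measure.restrict_pi_pi, Measure.restrict_pi_pi]
    congr 1
    ext1 i
    exact (Measure.restrict_congr_set Ioc_ae_eq_Icc).symm
  rw [this]
  rfl

lemma torusCoeff_eq {d : ℕ} (f : (Fin d → ℝ) → ℂ) (F : TT d → ℂ) (h : ∀ x, F (prj x) = f x)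
    (k : Fin d → ℤ) : torusCoeff f k = mFourierCoeff F k := by
  unfold torusCoeff mFourierCoeff
  rw [← box_integral]
  congr 1
  ext x
  rw [h, mF_prj, smul_eq_mul, mul_comm]
  simp

/-- complexification -/
def cx {d : ℕ} (U : C(TT d, ℝ)) : C(TT d, ℂ) := ⟨fun x => (U x : ℂ), by fun_prop⟩

lemma parseval_summable {d : ℕ} (U V : C(TT d, ℂ)) :
    Summable (fun k => ‖mFourierCoeff U k‖ * ‖mFourierCoeff V k‖) := by
  have := (parseval U V).summable.norm
  simpa using this

lemma parseval_real {d : ℕ} (U V : C(TT d, ℝ)) :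
    HasSum (fun k => (mFourierCoeff (cx U) k * (starRingEnd ℂ) (mFourierCoeff (cx V) k)).re)
      (∫ t, U t * V t) := by
  have h := parseval (cx V) (cx U)
  have h2 := Complex.hasSum_re h
  have : ∫ t, (starRingEnd ℂ) (cx V t) * (cx U t) = ((∫ t, U t * V t : ℝ) : ℂ) := by
    rw [← integral_complex_ofReal]
    congr 1; ext t; simp [cx, mul_comm]
  rw [this, Complex.ofReal_re] at h2
  simpa only [mul_comm] using h2

lemma diff_parseval {d : ℕ} (U V : C(TT d, ℝ)) (y : TT d) :
    HasSum (fun k => ‖mFourier k y - 1‖ ^ 2 *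
        (mFourierCoeff (cx U) k * (starRingEnd ℂ) (mFourierCoeff (cx V) k)).re)
      (∫ t, (U (t + y) - U t) * (V (t + y) - V t)) := by
  have key : ∀ W : C(TT d, ℝ), ∃ W' : C(TT d, ℝ), (∀ t, W' t = W (t + y) - W t) ∧
      ∀ k, mFourierCoeff (cx W') k = (mFourier k y - 1) * mFourierCoeff (cx W) k := by
    intro W
    refine ⟨⟨fun t => W (t + y) - W t, by fun_prop⟩, fun t => rfl, fun k => ?_⟩
    rw [sub_mul, one_mul, ← coeff_translate]
    unfold mFourierCoeff
    rw [← integral_sub]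
    · congr 1; ext t; simp [cx, mul_sub]
    · exact Continuous.integrable_of_hasCompactSupport (by fun_prop) (HasCompactSupport.of_compactSpace _)
    · exact Continuous.integrable_of_hasCompactSupport (by fun_prop) (HasCompactSupport.of_compactSpace _)
  obtain ⟨U', hU, hU'⟩ := key U
  obtain ⟨V', hV, hV'⟩ := key V
  have := parseval_real U' V'
  simp only [hU, hV, hU', hV'] at this
  convert this using 2 with k
  rw [map_mul, mul_mul_mul_comm, Complex.mul_conj, Complex.normSq_eq_norm_sq, Complex.re_ofReal_mul]

lemma integrate_symbol {d : ℕ} (b : (Fin d → ℤ) → ℝ) (hb : Summable (fun k => |b k|))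
    (h : ∀ y : TT d, 0 ≤ ∑' k, ‖mFourier k y - 1‖ ^ 2 * b k) (μ : Measure (TT d))
    [IsProbabilityMeasure μ] :
    0 ≤ ∑' k, 2 * (1 - (∫ y, mFourier k y ∂μ).re) * b k := by
  have e : ∀ k, ∫ y, ‖mFourier k y - 1‖ ^ 2 * b k ∂μ = 2 * (1 - (∫ y, mFourier k y ∂μ).re) * b k := by
    intro k
    rw [integral_mul_const]
    congr 1
    have hi : Integrable (fun y => mFourier k y) μ :=
      Continuous.integrable_of_hasCompactSupport (by fun_prop) (HasCompactSupport.of_compactSpace _)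
    have : ∀ y, ‖mFourier k y - 1‖ ^ 2 = 2 * (1 - (mFourier k y).re) := by
      intro y
      have h1 := mF_norm k y
      have h2 : (mFourier k y).re ^ 2 + (mFourier k y).im ^ 2 = 1 := by
        have := Complex.sq_norm (mFourier k y)
        rw [h1, Complex.normSq_apply] at this; nlinarith
      rw [Complex.sq_norm, Complex.normSq_apply]
      simp
      nlinarith
    simp only [this]
    have hi' : Integrable (fun y => (mFourier k y).re) μ := hi.re
    rw [integral_const_mul, integral_sub (integrable_const _) hi']
    have h3 : ∫ y, (mFourier k y).re ∂μ = (∫ y, mFourier k y ∂μ).re := integral_re hi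
    rw [h3]
    simp
  have := hasSum_integral_of_summable_integral_norm (μ := μ)
    (F := fun k y => ‖mFourier k y - 1‖ ^ 2 * b k) (fun k =>
      Continuous.integrable_of_hasCompactSupport (by fun_prop) (HasCompactSupport.of_compactSpace _)) ?_
  · simp only [e] at this
    rw [this.tsum_eq]
    exact integral_nonneg h
  · refine Summable.of_nonneg_of_le (fun k => integral_nonneg fun y => norm_nonneg _) ?_ (hb.mul_left 4)
    intro k
    calc ∫ y, ‖‖mFourier k y - 1‖ ^ 2 * b k‖ ∂μ ≤ ∫ y, 4 * |b k| ∂μ := by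
          apply integral_mono
          · exact Continuous.integrable_of_hasCompactSupport (by fun_prop) (HasCompactSupport.of_compactSpace _)
          · exact integrable_const _
          · intro y
            simp only [norm_mul, norm_pow, Real.norm_eq_abs]
            rw [abs_of_nonneg (norm_nonneg (mFourier k y - 1))]
            gcongr
            have : ‖mFourier k y - 1‖ ≤ 2 := by
              refine (norm_sub_le _ _).trans ?_
              rw [mF_norm]; norm_num
            nlinarith [norm_nonneg (mFourier k y - 1)]
      _ = 4 * |b k| := by simp

lemma haar_symbol {d : ℕ} (k : Fin d → ℤ) (hk : k ≠ 0) : ∫ y : TT d, mFourier k y = 0 := by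
  have := (orthonormal_iff_ite.1 (orthonormal_mFourier (d := Fin d))) 0 k
  rw [if_neg hk.symm, ContinuousMap.inner_toLp] at this
  simpa [mFourier_zero] using this

lemma gauss_symbol {d : ℕ} (t : ℝ) (ht : 0 ≤ t) : ∃ μ : Measure (TT d), IsProbabilityMeasure μ ∧
    ∀ k, (∫ y, mFourier k y ∂μ).re = Real.exp (-t * ∑ i, (k i : ℝ) ^ 2) := by
  have hm : Measurable (prj (d := d)) := prj_oqm.continuous.measurable
  set v : NNReal := (t / (2 * Real.pi ^ 2)).toNNReal with hv
  let γ : Measure (Fin d → ℝ) := Measure.pi fun _ => ProbabilityTheory.gaussianReal 0 v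
  refine ⟨γ.map prj, Measure.isProbabilityMeasure_map hm.aemeasurable, fun k => ?_⟩
  rw [integral_map hm.aemeasurable (by fun_prop)]
  have : ∀ y : Fin d → ℝ, mFourier k (prj y) = ∏ i, Complex.exp (((2 * Real.pi * k i : ℝ) : ℂ) * y i * Complex.I) := by
    intro y
    rw [mF_prj, ← Complex.exp_sum, Finset.mul_sum]
    congr 1
    apply Finset.sum_congr rfl
    intro i _
    push_cast; ring
  simp only [this]
  rw [integral_fintype_prod_eq_prod (f := fun i (y : ℝ) => Complex.exp (((2 * Real.pi * k i : ℝ) : ℂ) * y * Complex.I))]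
  have h2 : ∀ i, ∫ y : ℝ, Complex.exp (((2 * Real.pi * k i : ℝ) : ℂ) * y * Complex.I) ∂(ProbabilityTheory.gaussianReal 0 v) =
      ((Real.exp (-t * (k i : ℝ) ^ 2) : ℝ) : ℂ) := by
    intro i
    rw [← charFun_apply_real, ProbabilityTheory.charFun_gaussianReal, Complex.ofReal_exp]
    congr 1
    have : (v : ℝ) = t / (2 * Real.pi ^ 2) := Real.coe_toNNReal _ (by positivity)
    rw [show ((v : NNReal) : ℂ) = ((v : ℝ) : ℂ) from rfl, this]
    have := Real.pi_ne_zero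
    have h' : (Real.pi : ℂ) ≠ 0 := by exact_mod_cast this
    push_cast
    field_simp
    ring
  simp only [h2]
  rw [← Complex.ofReal_prod, Complex.ofReal_re, ← Real.exp_sum, Finset.mul_sum]

lemma deriv_coeff {d : ℕ} (f : (Fin d → ℝ) → ℝ) (hf : ContDiff ℝ 1 f)
    (hper : ∀ (x : Fin d → ℝ) (k : Fin d → ℤ), f (x + fun i => (k i : ℝ)) = f x) (i : Fin d)
    (k : Fin d → ℤ) :
    torusCoeff (fun x => ((fderiv ℝ f x (Pi.single i 1) : ℝ) : ℂ)) k =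
      (2 * Real.pi * Complex.I * k i) * torusCoeff (fun x => (f x : ℂ)) k := by
  set g : (Fin d → ℝ) → ℝ := fun x => fderiv ℝ f x (Pi.single i 1) with hg
  have gcont : Continuous g := (hf.continuous_fderiv one_ne_zero).clm_apply continuous_const
  have gper : ∀ (x : Fin d → ℝ) (k : Fin d → ℤ), g (x + fun i => (k i : ℝ)) = g x := by
    intro x k
    have : (fun y => f (y + fun i => (k i : ℝ))) = f := funext fun y => hper y k
    simp only [hg]
    rw [← fderiv_comp_add_right, this]
  obtain ⟨F, hF⟩ := descend f hf.continuous hper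
  obtain ⟨G, hG⟩ := descend g gcont gper
  have gbd : ∀ x, |g x| ≤ ‖G‖ := fun x => by
    rw [← hG]; exact G.norm_coe_le_norm _
  set E : (Fin d → ℝ) → ℂ := fun x =>
    Complex.exp (-(2 * Real.pi * Complex.I) * (∑ i, (k i : ℂ) * (x i : ℂ))) with hE
  have Econt : Continuous E := by fun_prop
  have Enorm : ∀ x, ‖E x‖ = 1 := by
    intro x
    have : E x = mFourier (-k) (prj x) := by
      rw [mF_prj]; simp [hE]
    rw [this, mF_norm]
  set ei : Fin d → ℝ := Pi.single i 1 with hei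
  have : IsFiniteMeasure (volume.restrict (unitBox d)) := by
    refine ⟨?_⟩
    rw [Measure.restrict_apply_univ]
    exact (isCompact_univ_pi fun _ => isCompact_Icc).measure_lt_top
  have hline : ∀ x (h : ℝ), HasDerivAt (fun h : ℝ => f (x + h • ei)) (g (x + h • ei)) h := by
    intro x h
    have h1 : HasFDerivAt f (fderiv ℝ f (x + h • ei)) (x + h • ei) :=
      (hf.differentiable one_ne_zero _).hasFDerivAt
    have h2 : HasDerivAt (fun h : ℝ => x + h • ei) ei h := by
      simpa using ((hasDerivAt_id h).smul_const ei).const_add x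
    exact h1.comp_hasDerivAt h h2
  have D1 := (hasDerivAt_integral_of_dominated_loc_of_deriv_le (𝕜 := ℝ)
    (μ := volume.restrict (unitBox d)) (x₀ := 0) (s := Set.univ)
    (F := fun h x => ((f (x + h • ei) : ℝ) : ℂ) * E x)
    (F' := fun h x => ((g (x + h • ei) : ℝ) : ℂ) * E x) (bound := fun _ => ‖G‖)
    Filter.univ_mem
    (Filter.Eventually.of_forall fun h => by
      have := hf.continuous
      exact Continuous.aestronglyMeasurable (by fun_prop))
    (by
      refine Integrable.mono' (integrable_const ‖F‖) (by
        have := hf.continuous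
        exact Continuous.aestronglyMeasurable (by fun_prop)) (Filter.Eventually.of_forall fun x => ?_)
      rw [norm_mul, Enorm, mul_one, Complex.norm_real, ← hF]; exact F.norm_coe_le_norm _)
    (Continuous.aestronglyMeasurable (by fun_prop))
    (Filter.Eventually.of_forall fun x h _ => by
      rw [norm_mul, Enorm, mul_one, Complex.norm_real]; exact gbd _)
    (integrable_const _)
    (Filter.Eventually.of_forall fun x h _ => ((hline x h).ofReal_comp).mul_const _)).2
  have D2 : ∀ h : ℝ, ∫ x in unitBox d, ((f (x + h • ei) : ℝ) : ℂ) * E x =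
      Complex.exp (2 * Real.pi * Complex.I * k i * h) * torusCoeff (fun x => (f x : ℂ)) k := by
    intro h
    have e1 := torusCoeff_eq (fun x => ((f (x + h • ei) : ℝ) : ℂ)) (fun t => (F (t + prj (h • ei)) : ℂ))
      (fun x => by rw [← prj_add, hF]) k
    have e2 := torusCoeff_eq (fun x => ((f x : ℝ) : ℂ)) (fun t => (F t : ℂ))
      (fun x => by rw [hF]) k
    rw [coeff_translate (fun t => (F t : ℂ)), ← e2, mF_prj] at e1
    have e3 : ∑ j, (k j : ℂ) * (((h • ei) j : ℝ) : ℂ) = k i * h := by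
      rw [Finset.sum_eq_single i]
      · simp [hei]
      · intro j _ hj; simp [hei, hj]
      · simp
    rw [e3, ← mul_assoc] at e1
    exact e1
  simp only [D2] at D1
  have D3 : HasDerivAt (fun h : ℝ => Complex.exp (2 * Real.pi * Complex.I * k i * h) *
      torusCoeff (fun x => (f x : ℂ)) k)
      ((2 * Real.pi * Complex.I * k i) * torusCoeff (fun x => (f x : ℂ)) k) 0 := by
    apply HasDerivAt.mul_const
    have h1 : HasDerivAt (fun h : ℝ => (2 * Real.pi * Complex.I * k i) * (h : ℂ))
        (2 * Real.pi * Complex.I * k i) 0 := by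
      simpa using (hasDerivAt_id (0:ℝ)).ofReal_comp.const_mul (2 * Real.pi * Complex.I * k i)
    simpa using h1.cexp
  have := D1.unique D3
  rw [← this]
  simp only [torusCoeff, hE, hg, zero_smul, add_zero]

lemma decay {d : ℕ} (f : (Fin d → ℝ) → ℝ) (hf : ContDiff ℝ (⊤ : ℕ∞) f)
    (hper : ∀ (x : Fin d → ℝ) (k : Fin d → ℤ), f (x + fun i => (k i : ℝ)) = f x)
    (V : C(TT d, ℂ)) :
    Summable fun k : Fin d → ℤ => (∑ i, (k i : ℝ) ^ 2) *
      (‖torusCoeff (fun x => (f x : ℂ)) k‖ * ‖mFourierCoeff V k‖) := by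
  have h1 : ∀ i : Fin d, Summable fun k : Fin d → ℤ => (k i : ℝ) ^ 2 *
      (‖torusCoeff (fun x => (f x : ℂ)) k‖ * ‖mFourierCoeff V k‖) := by
    intro i
    have aux : ∀ g : (Fin d → ℝ) → ℝ, ContDiff ℝ (⊤ : ℕ∞) g →
        (∀ (x : Fin d → ℝ) (k : Fin d → ℤ), g (x + fun i => (k i : ℝ)) = g x) →
        ContDiff ℝ (⊤ : ℕ∞) (fun x => fderiv ℝ g x (Pi.single i 1)) ∧
        (∀ (x : Fin d → ℝ) (k : Fin d → ℤ), fderiv ℝ g (x + fun i => (k i : ℝ)) (Pi.single i 1) =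
          fderiv ℝ g x (Pi.single i 1)) := by
      intro g hg gper
      refine ⟨(hg.fderiv_right (by simp)).clm_apply contDiff_const, fun x k => ?_⟩
      have : (fun y => g (y + fun i => (k i : ℝ))) = g := funext fun y => gper y k
      rw [← fderiv_comp_add_right, this]
    obtain ⟨c1, p1⟩ := aux f hf hper
    obtain ⟨c2, p2⟩ := aux _ c1 p1
    obtain ⟨G, hG⟩ := descend _ c2.continuous p2
    have e : ∀ k, mFourierCoeff (cx G) k = (2 * Real.pi * Complex.I * k i) *
        ((2 * Real.pi * Complex.I * k i) * torusCoeff (fun x => (f x : ℂ)) k) := by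
      intro k
      rw [← deriv_coeff f (hf.of_le (by norm_cast)) hper i k,
        ← deriv_coeff _ (c1.of_le (by norm_cast)) p1 i k]
      exact (torusCoeff_eq _ _ (fun x => by simp only [cx, ContinuousMap.coe_mk, hG]) k).symm
    have := (parseval_summable (cx G) V).mul_left (1 / (4 * Real.pi ^ 2))
    refine this.congr fun k => ?_
    rw [e]
    have hpi := Real.pi_pos
    simp only [norm_mul, Complex.norm_I, Complex.norm_real, Complex.norm_ofNat, Complex.norm_intCast,
      Real.norm_eq_abs, abs_of_pos hpi]
    rw [← sq_abs (k i : ℝ)]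
    field_simp
    ring
  have := summable_sum (s := Finset.univ) (fun i _ => h1 i)
  refine this.congr fun k => ?_
  rw [Finset.sum_mul]

lemma heat_lower {d : ℕ} (F G W : C(TT d, ℝ)) {c C : ℝ} (hc : 0 < c) (hC : 0 < C)
    (h1 : ∀ x y, c * (W x - W y) ^ 2 ≤ (F x - F y) * (G x - G y))
    (h2 : ∀ x y, (F x - F y) * (G x - G y) ≤ C * (W x - W y) ^ 2)
    (hF0 : mFourierCoeff (cx F) 0 = 0) (t : ℝ) (ht : 0 < t) :
    (c / C * ∫ x, F x * G x) * (1 - Real.exp (-t)) ≤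
      ∑' k : Fin d → ℤ, (1 - Real.exp (-t * ∑ i, (k i : ℝ) ^ 2)) *
        (mFourierCoeff (cx F) k * (starRingEnd ℂ) (mFourierCoeff (cx G) k)).re := by
  set a : (Fin d → ℤ) → ℝ := fun k =>
    (mFourierCoeff (cx F) k * (starRingEnd ℂ) (mFourierCoeff (cx G) k)).re with ha
  set w : (Fin d → ℤ) → ℝ := fun k =>
    (mFourierCoeff (cx W) k * (starRingEnd ℂ) (mFourierCoeff (cx W) k)).re with hw
  have w0 : ∀ k, 0 ≤ w k := by
    intro k
    simp only [hw]
    rw [Complex.mul_conj, Complex.ofReal_re]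
    exact Complex.normSq_nonneg _
  have sa : Summable a := (parseval_real F G).summable
  have sw : Summable w := (parseval_real W W).summable
  have a0 : a 0 = 0 := by simp [ha, hF0]
  have Int : ∀ (φ : TT d → ℝ), Continuous φ → Integrable φ := fun φ hφ =>
    hφ.integrable_of_hasCompactSupport (HasCompactSupport.of_compactSpace _)
  have y1 : ∀ y : TT d, 0 ≤ ∑' k, ‖mFourier k y - 1‖ ^ 2 * (a k - c * w k) := by
    intro y
    have e := (diff_parseval F G y).sub ((diff_parseval W W y).mul_left c)
    refine le_of_le_of_eq ?_ (e.tsum_eq.symm.trans (tsum_congr fun k => ?_))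
    swap
    · simp only [ha, hw]; ring
    rw [← integral_const_mul, sub_nonneg]
    apply integral_mono (Int _ (by fun_prop)) (Int _ (by fun_prop))
    intro x
    have := h1 (x + y) x
    simp only
    nlinarith
  have y2 : ∀ y : TT d, 0 ≤ ∑' k, ‖mFourier k y - 1‖ ^ 2 * (C * w k - a k) := by
    intro y
    have e := ((diff_parseval W W y).mul_left C).sub (diff_parseval F G y)
    refine le_of_le_of_eq ?_ (e.tsum_eq.symm.trans (tsum_congr fun k => ?_))
    swap
    · simp only [ha, hw]; ring
    rw [← integral_const_mul, sub_nonneg]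
    apply integral_mono (Int _ (by fun_prop)) (Int _ (by fun_prop))
    intro x
    have := h2 (x + y) x
    simp only
    nlinarith
  -- bounded symbols
  have bs : ∀ (m b : (Fin d → ℤ) → ℝ), (∀ k, 0 ≤ m k ∧ m k ≤ 1) → Summable b →
      Summable fun k => m k * b k := by
    intro m b hm hb
    refine Summable.of_norm_bounded hb.abs (fun k => ?_)
    rw [norm_mul, Real.norm_eq_abs, Real.norm_eq_abs, abs_of_nonneg (hm k).1]
    exact mul_le_of_le_one_left (abs_nonneg _) (hm k).2
  -- Haar
  set δ : (Fin d → ℤ) → ℝ := fun k => if k = 0 then 0 else 1 with hδ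
  have hδ1 : ∀ k, 0 ≤ δ k ∧ δ k ≤ 1 := by
    intro k; simp only [hδ]; split_ifs <;> norm_num
  have H1 : ∑' k, a k ≤ C * ∑' k, δ k * w k := by
    have := integrate_symbol _ ((sw.mul_left C).sub sa).abs y2 volume
    have e : ∀ k : Fin d → ℤ, 2 * (1 - (∫ y : TT d, mFourier k y).re) * (C * w k - a k) =
        2 * (C * (δ k * w k) - a k) := by
      intro k
      by_cases hk : k = 0
      · subst hk
        simp [hδ, a0, mFourier_zero]
      · rw [haar_symbol k hk]; simp [hδ, hk]
    simp only [e] at this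
    rw [tsum_mul_left, ((((bs δ w hδ1 sw).mul_left C)).tsum_sub sa), tsum_mul_left] at this
    linarith
  -- Gauss
  obtain ⟨μ, hμ, hμk⟩ := gauss_symbol (d := d) t ht.le
  set m : (Fin d → ℤ) → ℝ := fun k => 1 - Real.exp (-t * ∑ i, (k i : ℝ) ^ 2) with hm
  have hm1 : ∀ k, 0 ≤ m k ∧ m k ≤ 1 := by
    intro k
    have := exp_bounds (t := t * ∑ i, (k i : ℝ) ^ 2) (by positivity)
    simp only [hm, neg_mul]
    exact ⟨this.1, this.2.2⟩
  have H2 : c * ∑' k, m k * w k ≤ ∑' k, m k * a k := by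
    have := integrate_symbol _ (sa.sub (sw.mul_left c)).abs y1 μ
    simp only [hμk] at this
    have e : ∀ k, 2 * (1 - Real.exp (-t * ∑ i, (k i : ℝ) ^ 2)) * (a k - c * w k) =
        2 * (m k * a k - c * (m k * w k)) := by
      intro k; simp only [hm]; ring
    simp only [e] at this
    rw [tsum_mul_left, (bs m a hm1 sa).tsum_sub ((bs m w hm1 sw).mul_left c), tsum_mul_left] at this
    linarith
  have H3 : (1 - Real.exp (-t)) * ∑' k, δ k * w k ≤ ∑' k, m k * w k := by
    rw [← tsum_mul_left]
    refine ((bs δ w hδ1 sw).mul_left _).tsum_le_tsum (fun k => ?_) (bs m w hm1 sw)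
    rw [← mul_assoc]
    apply mul_le_mul_of_nonneg_right _ (w0 k)
    by_cases hk : k = 0
    · simp only [hδ, hk, if_true, mul_zero]; exact (hm1 0).1
    · simp only [hδ, hk, if_false, mul_one, hm]
      have := sum_sq_ge_one k hk
      have : Real.exp (-t * ∑ i, (k i : ℝ) ^ 2) ≤ Real.exp (-t) := by
        apply Real.exp_le_exp.2; nlinarith
      linarith
  have H4 : ∫ x, F x * G x = ∑' k, a k := (parseval_real F G).tsum_eq.symm
  rw [H4]
  have ht1 := (exp_bounds ht.le).1
  calc _ ≤ (c / C * (C * ∑' k, δ k * w k)) * (1 - Real.exp (-t)) := by gcongr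
    _ = c * ((1 - Real.exp (-t)) * ∑' k, δ k * w k) := by field_simp
    _ ≤ c * ∑' k, m k * w k := by gcongr
    _ ≤ _ := H2

theorem stmt_13 (d : ℕ) (hd : 1 ≤ d) (s p : ℝ) (hs0 : 0 < s) (hs2 : s ≤ 2) (hp : 1 < p) :
    ∃ c : ℝ, 0 < c ∧
      ∀ f : (Fin d → ℝ) → ℝ,
        ContDiff ℝ (⊤ : ℕ∞) f →
        (∀ (x : Fin d → ℝ) (k : Fin d → ℤ), f (x + fun i => (k i : ℝ)) = f x) →
        (∫ x in unitBox d, f x) = 0 →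
        c * (∫ x in unitBox d, |f x| ^ p) ≤
          (∑' k : Fin d → ℤ,
            (((Real.sqrt (∑ i, (k i : ℝ) ^ 2)) ^ s : ℝ) : ℂ) *
              (torusCoeff (fun x => (f x : ℂ)) k *
                (starRingEnd ℂ)
                  (torusCoeff (fun x => ((|f x| ^ (p - 2) * f x : ℝ) : ℂ)) k))).re := by
  obtain ⟨c, C, hc, hC, hcC⟩ := key_pointwise hp
  refine ⟨c / C, by positivity, fun f hf hper hmean => ?_⟩
  obtain ⟨F, hF⟩ := descend f hf.continuous hper
  have hp1 : 0 < p - 1 := by linarith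
  have hp2 : 0 < p / 2 := by linarith
  let G : C(TT d, ℝ) := ⟨fun x => spow (p - 1) (F x), (spow_continuous hp1).comp F.continuous⟩
  let W : C(TT d, ℝ) := ⟨fun x => spow (p / 2) (F x), (spow_continuous hp2).comp F.continuous⟩
  have eF : ∀ k, torusCoeff (fun x => (f x : ℂ)) k = mFourierCoeff (cx F) k := fun k =>
    torusCoeff_eq _ _ (fun x => by simp only [cx, ContinuousMap.coe_mk, hF]) k
  have eG : ∀ k, torusCoeff (fun x => ((|f x| ^ (p - 2) * f x : ℝ) : ℂ)) k =
      mFourierCoeff (cx G) k := fun k =>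
    torusCoeff_eq _ _ (fun x => by
      simp only [cx, G, ContinuousMap.coe_mk, hF, spow]
      rw [show p - 1 - 1 = p - 2 by ring]) k
  have hF0 : mFourierCoeff (cx F) 0 = 0 := by
    rw [← eF]
    simp only [torusCoeff, Pi.zero_apply, Int.cast_zero, zero_mul, Finset.sum_const_zero, mul_zero,
      Complex.exp_zero, mul_one]
    rw [integral_complex_ofReal, hmean, Complex.ofReal_zero]
  have hI : ∫ x in unitBox d, |f x| ^ p = ∫ x, F x * G x := by
    rw [← box_integral]
    congr 1
    ext x
    simp only [G, ContinuousMap.coe_mk, hF]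
    rw [← abs_rpow_eq hp, mul_comm]
  have hdec := decay f hf hper (cx G)
  simp only [eF] at hdec
  simp only [eF, eG]
  set q : (Fin d → ℤ) → ℝ := fun k => ∑ i, (k i : ℝ) ^ 2 with hq
  have q0 : ∀ k, 0 ≤ q k := fun k => Finset.sum_nonneg fun i _ => sq_nonneg _
  set A : (Fin d → ℤ) → ℂ := fun k =>
    mFourierCoeff (cx F) k * (starRingEnd ℂ) (mFourierCoeff (cx G) k) with hA
  have hAn : ∀ k, ‖A k‖ = ‖mFourierCoeff (cx F) k‖ * ‖mFourierCoeff (cx G) k‖ := by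
    intro k; simp [hA]
  have hdecA : Summable fun k => q k * ‖A k‖ := by
    simp only [hAn]; exact hdec
  have hq1 : ∀ k, q k = 0 ∨ 1 ≤ q k := by
    intro k
    by_cases hk : k = 0
    · left; simp [hq, hk]
    · right; exact sum_sq_ge_one k hk
  have hS : Summable fun k => q k * |(A k).re| :=
    Summable.of_nonneg_of_le (fun k => mul_nonneg (q0 k) (abs_nonneg _))
      (fun k => mul_le_mul_of_nonneg_left (Complex.abs_re_le_norm _) (q0 k)) hdecA
  have i0 : Fin d := ⟨0, hd⟩
  have main := (frac_of_heat q (fun k => (A k).re) hq1 (Pi.single i0 1) (by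
      simp only [hq]
      rw [Finset.sum_eq_single i0]
      · simp
      · intro j _ hj; simp [hj]
      · simp) hS (c / C * ∫ x, F x * G x)
      (fun t ht => heat_lower F G W hc hC (fun x y => (hcC (F x) (F y)).1)
        (fun x y => (hcC (F x) (F y)).2) hF0 t ht) hs0 hs2).2
  have hsq : ∀ k, (Real.sqrt (q k)) ^ s = q k ^ (s / 2) := by
    intro k
    rw [Real.sqrt_eq_rpow, ← Real.rpow_mul (q0 k)]
    congr 1; ring
  have hle : ∀ k, q k ^ (s / 2) ≤ q k := by
    intro k
    rcases hq1 k with h | h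
    · rw [h, Real.zero_rpow (by linarith)]
    · simpa using Real.rpow_le_rpow_of_exponent_le h (show s / 2 ≤ 1 by linarith)
  have hsumC : Summable fun k => (((Real.sqrt (q k)) ^ s : ℝ) : ℂ) * A k := by
    refine Summable.of_norm_bounded hdecA (fun k => ?_)
    rw [norm_mul, Complex.norm_real, hsq, Real.norm_of_nonneg (Real.rpow_nonneg (q0 k) _)]
    exact mul_le_mul_of_nonneg_right (hle k) (norm_nonneg _)
  rw [hI, Complex.re_tsum hsumC]
  simp only [Complex.re_ofReal_mul, hsq]
  exact main
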